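/- arXiv:nlin/0305051 — 8 statements merged into one kernel-verified Lean document; each statement's English description precedes it below -/
import Mathlib

section
/- Let f : {0,1}^n → [0,1] be a local function, let L ≥ n, and let c_1 < c_2 < ... < c_n be consecutive integers (c_{i+1} = c_i + 1) with c_1 ≤ 0. Define transition probabilities w(1|v) = f(v) and w(0|v) = 1 − f(v) for v ∈ {0,1}^n, and define the one-step transition kernel on cyclic configurations of length L by P(y|x) = ∏_{i=0}^{L−1} w(y_i | x_{i+c_1}, x_{i+c_2}, ..., x_{i+c_n}) (indices mod L). Then the following are equivalent: (i) for every probability distribution μ on {0,1}^L, the expected value of Σ_{i=0}^{L−1} s_i is the same under μ and under the one-step evolution of μ by the kernel P; (ii) Σ_{i=0}^{L−1} f(x_i, x_{i+1}, ..., x_{i+n−1}) = Σ_{i=0}^{L−1} x_i for every (x_0, ..., x_{L−1}) ∈ {0,1}^L (indices mod L). -/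
open Finset

theorem aux_expect {ι : Type*} [Fintype ι] [DecidableEq ι] (p : ι → Bool → ℝ)
    (hp : ∀ i, p i true + p i false = 1) :
    (∑ y : ι → Bool, (∏ i, p i (y i)) * (∑ i, ((y i).toNat : ℝ))) = ∑ i, p i true := by
  simp_rw [Finset.mul_sum]
  rw [Finset.sum_comm]
  refine Finset.sum_congr rfl fun i _ => ?_
  have h1 : ∀ y : ι → Bool, (∏ j, p j (y j)) * ((y i).toNat : ℝ) =
      ∏ j, (p j (y j) * if j = i then ((y j).toNat : ℝ) else 1) := by
    intro y
    rw [Finset.prod_mul_distrib, Finset.prod_ite_eq' Finset.univ i]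
    simp
  simp_rw [h1]
  have h2 := Finset.prod_univ_sum (fun _ : ι => (Finset.univ : Finset Bool))
    (fun j b => p j b * if j = i then ((b).toNat : ℝ) else 1)
  rw [Fintype.piFinset_univ] at h2
  rw [← h2]
  rw [Finset.prod_eq_single i]
  · simp
  · intro j _ hj
    simp [hj, hp]
  · simp

/-- A PCA on a cyclic lattice of length `L ≥ n` with local function
`f : {0,1}ⁿ → [0,1]`, neighbourhood offsets `c₁, c₁+1, …, c₁+n-1` (`c₁ ≤ 0`),
transition probabilities `w(1|v) = f v`, `w(0|v) = 1 - f v`, and kernel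
`P x y = ∏ᵢ w(yᵢ | x_{i+c₁}, …, x_{i+c₁+n-1})` conserves the expected number of
occupied sites for every initial distribution `μ` if and only if
`∑ᵢ f(xᵢ, x_{i+1}, …, x_{i+n-1}) = ∑ᵢ xᵢ` for every configuration `x ∈ {0,1}^L`. -/
theorem statement0 (n : ℕ) (hn : 0 < n) (f : (Fin n → Bool) → ℝ)
    (hf : ∀ v, f v ∈ Set.Icc (0 : ℝ) 1)
    (c₁ : ℤ) (hc₁ : c₁ ≤ 0)
    (L : ℕ) [NeZero L] (hL : n ≤ L)
    (w : Bool → (Fin n → Bool) → ℝ)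
    (hw1 : ∀ v, w true v = f v) (hw0 : ∀ v, w false v = 1 - f v)
    (P : (ZMod L → Bool) → (ZMod L → Bool) → ℝ)
    (hP : ∀ x y, P x y =
      ∏ i : ZMod L, w (y i) (fun j => x (i + ((c₁ + (j : ℕ) : ℤ) : ZMod L)))) :
    (∀ μ : (ZMod L → Bool) → ℝ, (∀ x, 0 ≤ μ x) → (∑ x, μ x) = 1 →
        (∑ y, (∑ x, μ x * P x y) * (∑ i : ZMod L, ((y i).toNat : ℝ))) =
          ∑ x, μ x * (∑ i : ZMod L, ((x i).toNat : ℝ))) ↔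
      (∀ x : ZMod L → Bool,
        (∑ i : ZMod L, f (fun j => x (i + ((j : ℕ) : ZMod L)))) =
          ∑ i : ZMod L, ((x i).toNat : ℝ)) := by
  have key : ∀ x, ∑ y, P x y * (∑ i : ZMod L, ((y i).toNat : ℝ)) =
      ∑ i : ZMod L, f (fun j => x (i + ((j : ℕ) : ZMod L))) := by
    intro x
    simp_rw [hP]
    rw [aux_expect (fun i b => w b (fun j => x (i + ((c₁ + (j : ℕ) : ℤ) : ZMod L))))
      (by intro i; simp only [hw1, hw0]; ring)]
    simp only [hw1]
    refine Fintype.sum_equiv (Equiv.addRight (c₁ : ZMod L)) _ _ fun i => ?_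
    simp [add_assoc]
  have key2 : ∀ μ : (ZMod L → Bool) → ℝ,
      (∑ y, (∑ x, μ x * P x y) * (∑ i : ZMod L, ((y i).toNat : ℝ))) =
      ∑ x, μ x * ∑ i : ZMod L, f (fun j => x (i + ((j : ℕ) : ZMod L))) := by
    intro μ
    simp_rw [← key, Finset.sum_mul]
    rw [Finset.sum_comm]
    refine Finset.sum_congr rfl fun x _ => ?_
    rw [Finset.mul_sum]
    exact Finset.sum_congr rfl fun y _ => mul_assoc _ _ _
  constructor
  · intro h x
    have h3 := h (fun z => if z = x then 1 else 0)
      (by intro z; split_ifs <;> norm_num) (by simp)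
    rw [key2] at h3
    simpa using h3
  · intro h μ _ _
    rw [key2]
    simp_rw [h]
end

section
/- A local function f : {0,1}^n → [0,1] is number-conserving if and only if for all (x_1, x_2, ..., x_n) ∈ {0,1}^n it satisfies f(x_1, x_2, ..., x_n) = x_1 + Σ_{k=1}^{n−1} [ f(0,0,...,0 (k zeros), x_2, x_3, ..., x_{n−k+1}) − f(0,0,...,0 (k zeros), x_1, x_2, ..., x_{n−k}) ]. -/
open Finset

/-- A local function `f : {0,1}ⁿ → ℝ` is number-conserving if for every cyclic
lattice size `L ≥ n` and every configuration `x ∈ {0,1}^L` (indices mod `L`),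
`∑ᵢ f(xᵢ, x_{i+1}, …, x_{i+n-1}) = ∑ᵢ xᵢ`. -/
def NumberConserving {n : ℕ} (f : (Fin n → Bool) → ℝ) : Prop :=
  ∀ L : ℕ, n ≤ L + 1 → ∀ x : ZMod (L + 1) → Bool,
    (∑ i : ZMod (L + 1), f (fun j => x (i + ((j : ℕ) : ZMod (L + 1))))) =
      ∑ i : ZMod (L + 1), ((x i).toNat : ℝ)

/-- Extension of a finite tuple `x : {0,1}^m` to `ℕ → Bool` by zeros. -/
def pad {m : ℕ} (x : Fin m → Bool) : ℕ → Bool :=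
  fun i => if h : i < m then x ⟨i, h⟩ else false

lemma nc_range {n : ℕ} {f : (Fin n → Bool) → ℝ} (h : NumberConserving f) (L : ℕ)
    (hL : n ≤ L + 1) (u : ℕ → Bool) :
    ∑ i ∈ range (L + 1), f (fun j => u ((i + (j : ℕ)) % (L + 1))) =
      ∑ i ∈ range (L + 1), ((u i).toNat : ℝ) := by
  have h1 := h L hL (fun a => u a.val)
  simp only [ZMod.val_add, ZMod.val_natCast, Nat.add_mod_mod] at h1
  rw [← Fin.sum_univ_eq_sum_range (fun i => f (fun j => u ((i + (j : ℕ)) % (L + 1)))),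
    ← Fin.sum_univ_eq_sum_range (fun i => ((u i).toNat : ℝ))]
  exact h1

lemma split_sum (m : ℕ) (F : ℕ → ℝ) :
    ∑ i ∈ range (2 * m + 1 + 1), F i =
      F 0 + ∑ i ∈ range m, F (i + 1) + ∑ i ∈ range (m + 1), F (m + 1 + (m - i)) := by
  rw [show 2 * m + 1 + 1 = (m + 1) + (m + 1) by ring, sum_range_add, sum_range_succ' _ m,
    ← sum_range_reflect (fun i => F (m + 1 + i)) (m + 1)]
  simp only [Nat.add_sub_cancel]
  ring

theorem statement1 (n : ℕ) (hn : 0 < n) (f : (Fin n → Bool) → ℝ)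
    (hf : ∀ v, f v ∈ Set.Icc (0 : ℝ) 1) :
    NumberConserving f ↔
      ∀ x : Fin n → Bool,
        f x = ((x ⟨0, hn⟩).toNat : ℝ) +
          ∑ k ∈ Finset.Icc 1 (n - 1),
            (f (fun j => if (j : ℕ) < k then false else pad x ((j : ℕ) - k + 1)) -
             f (fun j => if (j : ℕ) < k then false else pad x ((j : ℕ) - k))) := by
  constructor
  · intro h x
    obtain ⟨m, rfl⟩ : ∃ m, n = m + 1 := ⟨n - 1, by omega⟩
    have hz : f (fun _ => false) = 0 := by
      have := nc_range h m le_rfl (fun _ => false)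
      simp at this
      rcases this with h | h
      · exfalso
        have : (0 : ℝ) ≤ m := Nat.cast_nonneg m
        linarith
      · exact h
    set A : ℕ → ℝ := fun k =>
      f (fun j => if (j : ℕ) < k then false else pad x ((j : ℕ) - k + 1)) with hA
    set B : ℕ → ℝ := fun k =>
      f (fun j => if (j : ℕ) < k then false else pad x ((j : ℕ) - k)) with hB
    have zA : ∀ k, m + 1 ≤ k → A k = 0 := by
      intro k hk
      rw [← hz]
      simp only [hA]
      congr 1
      funext j
      rw [if_pos (by omega)]
    have zB : ∀ k, m + 1 ≤ k → B k = 0 := by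
      intro k hk
      rw [← hz]
      simp only [hB]
      congr 1
      funext j
      rw [if_pos (by omega)]
    have e1 := nc_range h (2 * m + 1) (by omega) (pad x)
    have e2 := nc_range h (2 * m + 1) (by omega) (fun i => if i = 0 then false else pad x i)
    rw [split_sum, sum_range_succ' _ (2 * m + 1)] at e1 e2
    have a1 : f (fun j => pad x ((0 + (j : ℕ)) % (2 * m + 1 + 1))) = f x := by
      congr 1
      funext j
      rw [Nat.mod_eq_of_lt (by omega), pad, dif_pos (by omega)]
      congr 1
      exact Fin.ext (Nat.zero_add _)
    have a2 : f (fun j : Fin (m + 1) => if (0 + (j : ℕ)) % (2 * m + 1 + 1) = 0 then false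
        else pad x ((0 + (j : ℕ)) % (2 * m + 1 + 1))) = A 1 := by
      simp only [hA]
      congr 1
      funext j
      rw [Nat.mod_eq_of_lt (by omega)]
      by_cases hj : (j : ℕ) = 0
      · simp [hj]
      · rw [if_neg (by omega), if_neg (by omega)]
        congr 1
        omega
    have b : ∑ i ∈ range m, f (fun j : Fin (m + 1) =>
          if (i + 1 + (j : ℕ)) % (2 * m + 1 + 1) = 0 then false
        else pad x ((i + 1 + (j : ℕ)) % (2 * m + 1 + 1))) =
        ∑ i ∈ range m, f (fun j => pad x ((i + 1 + (j : ℕ)) % (2 * m + 1 + 1))) := by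
      refine sum_congr rfl fun i hi => ?_
      rw [mem_range] at hi
      congr 1
      funext j
      rw [Nat.mod_eq_of_lt (by omega), if_neg (by omega)]
    have key : ∀ i, i < m + 1 → ∀ j : Fin (m + 1),
        (m + 1 + (m - i) + (j : ℕ)) % (2 * m + 1 + 1) =
          if (j : ℕ) < i + 1 then 2 * m + 1 - i + j else j - (i + 1) := by
      intro i hi j
      split_ifs with hj
      · rw [Nat.mod_eq_of_lt (by omega)]; omega
      · rw [Nat.mod_eq_sub_mod (by omega), Nat.mod_eq_of_lt (by omega)]; omega
    have c1 : ∑ i ∈ range (m + 1), f (fun j : Fin (m + 1) =>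
        pad x ((m + 1 + (m - i) + (j : ℕ)) % (2 * m + 1 + 1))) =
        ∑ i ∈ range (m + 1), B (i + 1) := by
      refine sum_congr rfl fun i hi => ?_
      rw [mem_range] at hi
      simp only [hB]
      congr 1
      funext j
      rw [key i hi j]
      split_ifs with hj
      · rw [pad, dif_neg (by omega)]
      · rfl
    have c2 : ∑ i ∈ range (m + 1), f (fun j : Fin (m + 1) =>
        if (m + 1 + (m - i) + (j : ℕ)) % (2 * m + 1 + 1) = 0 then false else
        pad x ((m + 1 + (m - i) + (j : ℕ)) % (2 * m + 1 + 1))) =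
        ∑ i ∈ range (m + 1), A (i + 1 + 1) := by
      refine sum_congr rfl fun i hi => ?_
      rw [mem_range] at hi
      simp only [hA]
      congr 1
      funext j
      rw [key i hi j]
      by_cases hj : (j : ℕ) < i + 1
      · rw [if_pos hj, if_neg (by omega), if_pos (by omega), pad, dif_neg (by omega)]
      · rw [if_neg hj]
        by_cases hj' : (j : ℕ) = i + 1
        · rw [if_pos (by omega), if_pos (by omega)]
        · rw [if_neg (by omega), if_neg (by omega)]
          congr 1
          omega
    rw [a1, c1] at e1
    rw [a2, b, c2] at e2
    have p0 : pad x 0 = x ⟨0, hn⟩ := by simp [pad]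
    simp only [p0] at e1
    simp at e2
    have sA : ∑ i ∈ range (m + 1), A (i + 1 + 1) + A 1 = ∑ i ∈ range m, A (i + 1) := by
      rw [← sum_range_succ' (fun i => A (i + 1)) (m + 1), sum_range_succ, sum_range_succ,
        zA (m + 1) le_rfl, zA (m + 1 + 1) (by omega)]
      ring
    rw [sum_range_succ _ m, zB (m + 1) le_rfl] at e1
    have r : ∑ k ∈ Finset.Icc 1 (m + 1 - 1), (A k - B k) =
        ∑ i ∈ range m, A (i + 1) - ∑ i ∈ range m, B (i + 1) := by
      rw [← sum_sub_distrib, Nat.add_sub_cancel, Finset.range_eq_Ico,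
        Finset.sum_Ico_add' (fun k => A k - B k) 0 m 1]
      rfl
    rw [r]
    linarith
  · intro h L hL x
    have hs : ∀ i : ZMod (L + 1), f (fun j => x (i + ((j : ℕ) : ZMod (L + 1)))) =
        ((x i).toNat : ℝ) + ∑ k ∈ Finset.Icc 1 (n - 1),
          (f (fun j => if (j : ℕ) < k then false else
              x ((i + 1) + (((j : ℕ) - k : ℕ) : ZMod (L + 1)))) -
           f (fun j => if (j : ℕ) < k then false else
              x (i + (((j : ℕ) - k : ℕ) : ZMod (L + 1))))) := by
      intro i
      rw [h]
      congr 1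
      · simp
      · refine sum_congr rfl fun k hk => ?_
        rw [mem_Icc] at hk
        congr 2
        · funext j
          split_ifs with hj
          · rfl
          · rw [pad, dif_pos (by omega)]
            congr 1
            push_cast
            ring
        · funext j
          split_ifs with hj
          · rfl
          · rw [pad, dif_pos (by omega)]
    rw [sum_congr rfl fun i _ => hs i, sum_add_distrib, sum_comm, add_eq_left]
    refine sum_eq_zero fun k _ => ?_
    rw [sum_sub_distrib, sub_eq_zero]
    exact Equiv.sum_comp (Equiv.addRight (1 : ZMod (L + 1))) (fun i =>
      f (fun j => if (j : ℕ) < k then false else x (i + (((j : ℕ) - k : ℕ) : ZMod (L + 1)))))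
end

section
/- If a local function f : {0,1}^n → [0,1] is number-conserving, then f is 1-balanced, i.e., Σ_{(x_1, x_2, ..., x_n) ∈ {0,1}^n} f(x_1, x_2, ..., x_n) = 2^{n−1}. -/
open Finset

theorem sum_coord (m : ℕ) (i : ZMod (m+1)) :
    (∑ x : ZMod (m+1) → Bool, ((x i).toNat : ℝ)) = 2 ^ m := by
  have h1 : (∑ x : ZMod (m+1) → Bool, ((x i).toNat : ℝ)) =
      ∑ x : ZMod (m+1) → Bool, ((!(x i)).toNat : ℝ) := by
    refine Fintype.sum_equiv (Equiv.piCongrRight fun _ => Equiv.boolNot) _ _ ?_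
    intro x
    simp [Equiv.piCongrRight]
  have h2 : (∑ x : ZMod (m+1) → Bool, ((x i).toNat : ℝ)) +
      ∑ x : ZMod (m+1) → Bool, ((!(x i)).toNat : ℝ) = 2 ^ (m+1) := by
    rw [← Finset.sum_add_distrib]
    have : ∀ x : ZMod (m+1) → Bool, ((x i).toNat : ℝ) + ((!(x i)).toNat : ℝ) = 1 := by
      intro x
      cases x i <;> simp
    simp [this, ZMod.card]
  rw [← h1, pow_succ] at h2
  linarith

/-- if a local function `f : {0,1}ⁿ → [0,1]` is number-conserving,
then `f` is 1-balanced: `∑_{x ∈ {0,1}ⁿ} f x = 2^(n-1)`. -/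
theorem statement3 (n : ℕ) (hn : 0 < n) (f : (Fin n → Bool) → ℝ)
    (hf : ∀ v, f v ∈ Set.Icc (0 : ℝ) 1)
    (hcons : NumberConserving f) :
    (∑ x : Fin n → Bool, f x) = 2 ^ (n - 1) := by
  obtain ⟨m, rfl⟩ : ∃ m, n = m + 1 := ⟨n - 1, by omega⟩
  have h := Finset.sum_congr (rfl : (Finset.univ : Finset (ZMod (m+1) → Bool)) = Finset.univ)
    (fun x _ => hcons m le_rfl x)
  rw [Finset.sum_comm, Finset.sum_comm (f := fun (x : ZMod (m+1) → Bool) (i : ZMod (m+1)) => ((x i).toNat : ℝ))] at h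
  simp only [sum_coord] at h
  have key : ∀ i : ZMod (m+1), (∑ x : ZMod (m+1) → Bool,
      f (fun j => x (i + ((j : ℕ) : ZMod (m + 1))))) = ∑ x : Fin (m+1) → Bool, f x := by
    intro i
    let e : Fin (m+1) ≃ ZMod (m+1) := (Equiv.addLeft i : ZMod (m+1) ≃ ZMod (m+1))
    refine Fintype.sum_equiv (Equiv.arrowCongr e.symm (Equiv.refl Bool)) _ _ ?_
    intro x
    congr 1
    funext j
    have : ((j : ℕ) : ZMod (m+1)) = (show ZMod (m+1) from j) :=
      ZMod.natCast_zmod_val (n := m+1) (show ZMod (m+1) from j)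
    rw [this]
    rfl
  simp only [key, Finset.sum_const, Finset.card_univ, ZMod.card, nsmul_eq_mul] at h
  have hm : ((m + 1 : ℕ) : ℝ) ≠ 0 := by positivity
  simpa using mul_left_cancel₀ hm h
end

section
/- Let f : {0,1}^n → [0,1] be a local function, let m be an integer with 0 ≤ m ≤ n−1, and define the current J : {0,1}^{n−1} → ℝ by J(x_1, x_2, ..., x_{n−1}) = − Σ_{k=1}^{n−1} f(0,0,...,0 (k zeros), x_1, x_2, ..., x_{n−k}) + Σ_{j=1}^{m} x_j. Then f is number-conserving if and only if for all (x_1, x_2, ..., x_n) ∈ {0,1}^n, f(x_1, x_2, ..., x_n) − x_{m+1} = J(x_1, x_2, ..., x_{n−1}) − J(x_2, x_3, ..., x_n). -/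
open Finset

lemma keyA (N : ℕ) (f : (Fin (N+1) → Bool) → ℝ) (h : NumberConserving f) (y : ℕ → Bool)
    (hy : ∀ i, N < i → y i = false) :
    f (fun j => y j) + ∑ i ∈ Finset.range N, f (fun j => y (i + 1 + j))
      + ∑ k ∈ Finset.range N, f (fun j => if (j : ℕ) < k + 1 then false else y (j - (k + 1)))
      = ((y 0).toNat : ℝ) + ∑ i ∈ Finset.range N, ((y (i + 1)).toNat : ℝ) := by
  have h1 := h (2 * N) (by omega) (fun i => y (ZMod.val i))
  have e1 : (∑ i : ZMod (2 * N + 1), ((y (ZMod.val i)).toNat : ℝ))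
      = ∑ i ∈ Finset.range (2 * N + 1), ((y i).toNat : ℝ) :=
    Fin.sum_univ_eq_sum_range (fun i => ((y i).toNat : ℝ)) (2 * N + 1)
  have e2 : (∑ i : ZMod (2 * N + 1), f (fun j : Fin (N+1) => y (ZMod.val (i + ((j : ℕ) : ZMod (2 * N + 1))))))
      = ∑ i ∈ Finset.range (2 * N + 1), f (fun j => y ((i + j) % (2 * N + 1))) := by
    rw [← Fin.sum_univ_eq_sum_range (fun i => f (fun j => y ((i + j) % (2 * N + 1)))) (2 * N + 1)]
    apply Finset.sum_congr rfl
    intro i _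
    congr 1
    funext j
    rw [ZMod.val_add, ZMod.val_natCast, Nat.add_mod_mod]
    rfl
  rw [e1, e2, show 2 * N + 1 = (N + 1) + N by ring, Finset.sum_range_add _ (N + 1) N, Finset.sum_range_add _ (N + 1) N,
    Finset.sum_range_succ' _ N, Finset.sum_range_succ' _ N] at h1
  have e3 : ∑ x ∈ Finset.range N, ((y (N + 1 + x)).toNat : ℝ) = 0 := by
    apply Finset.sum_eq_zero
    intro i _
    rw [hy _ (by omega)]; simp
  have e4 : f (fun j : Fin (N+1) => y ((0 + (j : ℕ)) % (N + 1 + N))) = f (fun j => y j) := by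
    congr 1; funext j
    have := j.2
    rw [Nat.mod_eq_of_lt (by omega), zero_add]
  have e5 : ∑ i ∈ Finset.range N, f (fun j : Fin (N+1) => y ((i + 1 + (j : ℕ)) % (N + 1 + N)))
      = ∑ i ∈ Finset.range N, f (fun j => y (i + 1 + j)) := by
    apply Finset.sum_congr rfl
    intro i hi
    have := Finset.mem_range.1 hi
    congr 1; funext j
    have := j.2
    rw [Nat.mod_eq_of_lt (by omega)]
  have e6 : ∑ i ∈ Finset.range N, f (fun j : Fin (N+1) => y ((N + 1 + i + (j : ℕ)) % (N + 1 + N)))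
      = ∑ k ∈ Finset.range N, f (fun j => if (j : ℕ) < k + 1 then false else y (j - (k + 1))) := by
    rw [← Finset.sum_range_reflect]
    apply Finset.sum_congr rfl
    intro i hi
    have := Finset.mem_range.1 hi
    congr 1; funext j
    have := j.2
    split_ifs with hj
    · rw [Nat.mod_eq_of_lt (by omega)]
      exact hy _ (by omega)
    · rw [Nat.mod_eq_sub_mod (by omega), Nat.mod_eq_of_lt (by omega)]
      congr 1; omega
  rw [e3, e4, e5, e6] at h1
  linarith

lemma keyB (N : ℕ) (f : (Fin (N+1) → Bool) → ℝ) (h : NumberConserving f) (y : ℕ → Bool)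
    (hy : ∀ i, N < i → y i = false) :
    f (fun j => y j) - ((y 0).toNat : ℝ) =
      - ∑ k ∈ Finset.range N, f (fun j => if (j : ℕ) < k + 1 then false else y (j - (k + 1)))
      + ∑ k ∈ Finset.range N, f (fun j => if (j : ℕ) < k + 1 then false else y (j - (k + 1) + 1)) := by
  have h1 := keyA N f h y hy
  have h2 := keyA N f h (fun i => if i = 0 then false else y i)
    (by intro i hi; split_ifs; rfl; exact hy i hi)
  have h0 := keyA N f h (fun _ => false) (fun _ _ => rfl)
  simp only [ite_self, Finset.sum_const, Finset.card_range, nsmul_eq_mul, Bool.toNat_false,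
    Nat.cast_zero, mul_zero, add_zero] at h0
  have hz : f (fun _ => false) = 0 := by
    have : f (fun _ => false) * (2 * N + 1) = 0 := by linarith
    rcases mul_eq_zero.1 this with h | h
    · exact h
    · exact absurd h (by positivity)
  set G : ℕ → ℝ := fun k => f (fun j => if (j : ℕ) < k + 1 then false else y (j - (k + 1) + 1)) with hG
  have g0 : f (fun j : Fin (N+1) => if (j : ℕ) = 0 then false else y j) = G 0 := by
    simp only [hG]
    congr 1; funext j
    by_cases hj : (j : ℕ) = 0
    · simp [hj]
    · rw [if_neg hj, if_neg (by omega)]; congr 1; omega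
  have gN : G N = 0 := by
    rw [← hz]; simp only [hG]
    congr 1; funext j
    rw [if_pos j.2]
  have gs : ∑ k ∈ Finset.range N, f (fun j : Fin (N+1) => if (j : ℕ) < k + 1 then false else
      (if (j : ℕ) - (k + 1) = 0 then false else y (j - (k + 1)))) = ∑ k ∈ Finset.range N, G (k + 1) := by
    apply Finset.sum_congr rfl
    intro k _
    simp only [hG]
    congr 1; funext j
    by_cases a : (j : ℕ) < k + 1
    · rw [if_pos a, if_pos (by omega)]
    · rw [if_neg a]
      by_cases b : (j : ℕ) - (k + 1) = 0
      · rw [if_pos b, if_pos (by omega)]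
      · rw [if_neg b, if_neg (by omega)]; congr 1; omega
  have gt := Finset.sum_range_succ G N
  rw [Finset.sum_range_succ'] at gt
  have gm : ∀ i : ℕ, ∀ j : ℕ, ¬ (i + 1 + j = 0) := by intros; omega
  simp only [gm, if_false, if_true, Nat.succ_ne_zero, Bool.toNat_false, Nat.cast_zero] at h2
  rw [g0, gs] at h2
  change _ = _ + ∑ k ∈ Finset.range N, G k
  linarith

/-- let `f : {0,1}ⁿ → [0,1]`, let `0 ≤ m ≤ n-1`, and define the current
`J(x₁,…,x_{n-1}) = -∑_{k=1}^{n-1} f(0^k, x₁, …, x_{n-k}) + ∑_{j=1}^{m} x_j`.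
Then `f` is number-conserving iff for all `(x₁,…,xₙ) ∈ {0,1}ⁿ`,
`f(x₁,…,xₙ) - x_{m+1} = J(x₁,…,x_{n-1}) - J(x₂,…,xₙ)`. -/
theorem statement4 (n : ℕ) (hn : 0 < n) (m : ℕ) (hm : m ≤ n - 1)
    (f : (Fin n → Bool) → ℝ) (hf : ∀ v, f v ∈ Set.Icc (0 : ℝ) 1)
    (J : (Fin (n - 1) → Bool) → ℝ)
    (hJ : ∀ x : Fin (n - 1) → Bool,
      J x = -(∑ k ∈ Finset.Icc 1 (n - 1),
                f (fun j => if (j : ℕ) < k then false else pad x ((j : ℕ) - k))) +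
            ∑ j ∈ Finset.range m, ((pad x j).toNat : ℝ)) :
    NumberConserving f ↔
      ∀ x : Fin n → Bool,
        f x - ((x ⟨m, by omega⟩).toNat : ℝ) =
          J (fun j => x ⟨(j : ℕ), by have := j.2; omega⟩) -
            J (fun j => x ⟨(j : ℕ) + 1, by have := j.2; omega⟩) := by
  
  obtain ⟨N, rfl⟩ : ∃ N, n = N + 1 := ⟨n - 1, by omega⟩
  have hm' : m ≤ N := by simpa using hm
  constructor
  · intro h x
    have hb := keyB N f h (pad x) (by
      intro i hi; unfold pad; rw [dif_neg (by omega)])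
    have px : ∀ j : ℕ, ∀ hj : j < N + 1, pad x j = x ⟨j, hj⟩ := by
      intro j hj; unfold pad; rw [dif_pos hj]
    have p1 : ∀ j : ℕ, j < N → pad (m := N + 1 - 1) (fun j => x ⟨(j : ℕ), by have := j.2; omega⟩) j = pad x j := by
      intro j hj; unfold pad; rw [dif_pos (by simpa using hj), dif_pos (by omega)]
    have p2 : ∀ j : ℕ, j < N → pad (m := N + 1 - 1) (fun j => x ⟨(j : ℕ) + 1, by have := j.2; omega⟩) j = pad x (j + 1) := by
      intro j hj; unfold pad; rw [dif_pos (by simpa using hj), dif_pos (by omega)]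
    have fx : f (fun j => pad x j) = f x := by
      congr 1; funext j; rw [px _ j.2]
    have key : ∀ (z : Fin (N + 1 - 1) → Bool) (w : ℕ → Bool), (∀ j, j < N → pad z j = w j) →
        J z = -(∑ k ∈ Finset.range N, f (fun j => if (j : ℕ) < k + 1 then false else w (j - (k + 1))))
          + ∑ j ∈ Finset.range m, ((w j).toNat : ℝ) := by
      intro z w hw
      rw [hJ]
      congr 1
      · congr 1
        rw [Finset.range_eq_Ico, Finset.sum_Ico_add' (fun k => f (fun j : Fin (N+1) => if (j : ℕ) < k then false else w (j - k))) 0 N 1]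
        apply Finset.sum_congr
        · ext k; simp only [Finset.mem_Icc, Finset.mem_Ico]; omega
        · intro k hk
          have := Finset.mem_Ico.1 hk
          congr 1; funext j
          have := j.2
          split_ifs with a
          · rfl
          · exact hw _ (by omega)
      · apply Finset.sum_congr rfl
        intro j hj
        have := Finset.mem_range.1 hj
        rw [hw j (by omega)]
    rw [key _ _ p1, key _ (fun j => pad x (j + 1)) p2, ← px m (by omega)]
    have t1 := Finset.sum_range_succ (fun j => ((pad x j).toNat : ℝ)) m
    rw [Finset.sum_range_succ'] at t1
    rw [fx] at hb
    linarith
  · intro h L hL x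
    have h1 : ∑ i : ZMod (L + 1), (f (fun j => x (i + ((j : ℕ) : ZMod (L + 1)))) - ((x (i + (m : ZMod (L + 1)))).toNat : ℝ))
      = ∑ i : ZMod (L + 1), (J (fun j => x (i + ((j : ℕ) : ZMod (L + 1)))) - J (fun j => x ((i + 1) + ((j : ℕ) : ZMod (L + 1))))) := by
      apply Finset.sum_congr rfl
      intro i _
      have := h (fun j => x (i + ((j : ℕ) : ZMod (L + 1))))
      simp only at this
      rw [this]
      congr 3
      funext j
      congr 1
      push_cast
      ring
    have a1 := Equiv.sum_comp (Equiv.addRight (1 : ZMod (L + 1))) (fun i => J (fun j => x (i + ((j : ℕ) : ZMod (L + 1)))))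
    have a2 := Equiv.sum_comp (Equiv.addRight (m : ZMod (L + 1))) (fun i => ((x i).toNat : ℝ))
    simp only [Equiv.coe_addRight] at a1 a2
    rw [Finset.sum_sub_distrib, Finset.sum_sub_distrib, a1, a2] at h1
    linarith
end

section
/- A local function f : {0,1}^3 → [0,1] is number-conserving if and only if there exist real numbers α, β, γ satisfying α ≥ 0, β ≥ 0, α + β ≤ 1, α + γ ≤ 1, and β − γ ≤ 1, such that f(x_1, x_2, x_3) = γ(x_1 x_2 − x_2 x_3) + α x_1 + (1 − α − β) x_2 + β x_3 for all (x_1, x_2, x_3) ∈ {0,1}^3. Moreover, in that case α, β, γ are uniquely determined: α = f(1,0,0), β = f(0,0,1), and γ = f(1,1,0) + f(0,0,1) − 1. -/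
open Finset

lemma nc_three {f : (Fin 3 → Bool) → ℝ} (h : NumberConserving f) (a b c : Bool) :
    f ![a, b, c] + f ![b, c, a] + f ![c, a, b] =
      (a.toNat : ℝ) + (b.toNat : ℝ) + (c.toNat : ℝ) := by
  have h1 := h 2 (by norm_num) (![a, b, c] : Fin 3 → Bool)
  have e := Fin.sum_univ_three (fun i : Fin 3 =>
    f (fun j => (![a, b, c] : Fin 3 → Bool) ((show ZMod (2 + 1) from i) + ((j : ℕ) : ZMod (2 + 1)))))
  have e2 := Fin.sum_univ_three (fun i : Fin 3 => (((![a, b, c] : Fin 3 → Bool) i).toNat : ℝ))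
  have h2 := e.symm.trans (h1.trans e2)
  refine Eq.trans ?_ h2
  congr 1
  · congr 1
    all_goals
      congr 1
      funext j
      fin_cases j <;> rfl
  · congr 1
    funext j
    fin_cases j <;> rfl

lemma nc_four {f : (Fin 3 → Bool) → ℝ} (h : NumberConserving f) (a b c d : Bool) :
    f ![a, b, c] + f ![b, c, d] + f ![c, d, a] + f ![d, a, b] =
      (a.toNat : ℝ) + (b.toNat : ℝ) + (c.toNat : ℝ) + (d.toNat : ℝ) := by
  have h1 := h 3 (by norm_num) (![a, b, c, d] : Fin 4 → Bool)
  have e := Fin.sum_univ_four (fun i : Fin 4 =>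
    f (fun j => (![a, b, c, d] : Fin 4 → Bool) ((show ZMod (3 + 1) from i) + ((j : ℕ) : ZMod (3 + 1)))))
  have e2 := Fin.sum_univ_four (fun i : Fin 4 =>
    (((![a, b, c, d] : Fin 4 → Bool) i).toNat : ℝ))
  have h2 := e.symm.trans (h1.trans e2)
  refine Eq.trans ?_ h2
  congr 1
  · congr 1
    · congr 1
      all_goals
        congr 1
        funext j
        fin_cases j <;> rfl
    · congr 1
      funext j
      fin_cases j <;> rfl
  · congr 1
    funext j
    fin_cases j <;> rfl

/-- a local function `f : {0,1}³ → [0,1]` is number-conserving iff there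
exist reals `α, β, γ` with `α ≥ 0`, `β ≥ 0`, `α+β ≤ 1`, `α+γ ≤ 1`, `β-γ ≤ 1` such that
`f(x₁,x₂,x₃) = γ(x₁x₂ - x₂x₃) + αx₁ + (1-α-β)x₂ + βx₃`.  Moreover, in that case
`α, β, γ` are uniquely determined: `α = f(1,0,0)`, `β = f(0,0,1)`,
`γ = f(1,1,0) + f(0,0,1) - 1`. -/
theorem statement5 (f : (Fin 3 → Bool) → ℝ) (hf : ∀ v, f v ∈ Set.Icc (0 : ℝ) 1) :
    (NumberConserving f ↔
      ∃ α β γ : ℝ,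
        (0 ≤ α ∧ 0 ≤ β ∧ α + β ≤ 1 ∧ α + γ ≤ 1 ∧ β - γ ≤ 1) ∧
        ∀ x : Fin 3 → Bool,
          f x = γ * (((x 0).toNat : ℝ) * ((x 1).toNat : ℝ) -
                      ((x 1).toNat : ℝ) * ((x 2).toNat : ℝ)) +
                α * ((x 0).toNat : ℝ) + (1 - α - β) * ((x 1).toNat : ℝ) +
                β * ((x 2).toNat : ℝ)) ∧
    (∀ α β γ : ℝ,
      ((0 ≤ α ∧ 0 ≤ β ∧ α + β ≤ 1 ∧ α + γ ≤ 1 ∧ β - γ ≤ 1) ∧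
        ∀ x : Fin 3 → Bool,
          f x = γ * (((x 0).toNat : ℝ) * ((x 1).toNat : ℝ) -
                      ((x 1).toNat : ℝ) * ((x 2).toNat : ℝ)) +
                α * ((x 0).toNat : ℝ) + (1 - α - β) * ((x 1).toNat : ℝ) +
                β * ((x 2).toNat : ℝ)) →
      α = f ![true, false, false] ∧ β = f ![false, false, true] ∧
        γ = f ![true, true, false] + f ![false, false, true] - 1) := by
  constructor
  · constructor
    · intro h
      have t0 := nc_three h false false false
      have t1 := nc_three h true false false
      have t2 := nc_three h true true false
      have t3 := nc_three h true true true
      have q := nc_four h true true false false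
      simp only [Bool.toNat_true, Bool.toNat_false, Nat.cast_one, Nat.cast_zero] at t0 t1 t2 t3 q
      refine ⟨f ![true, false, false], f ![false, false, true],
        f ![true, true, false] + f ![false, false, true] - 1, ⟨(hf _).1, (hf _).1, ?_, ?_, ?_⟩, ?_⟩
      · linarith [(hf ![false, true, false]).1]
      · linarith [(hf ![false, true, true]).1]
      · linarith [(hf ![true, true, false]).1]
      · intro x
        have hx : x = ![x 0, x 1, x 2] := by
          funext j
          fin_cases j <;> rfl
        generalize x 0 = a at *
        generalize x 1 = b at *
        generalize x 2 = c at *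
        subst hx
        cases a <;> cases b <;> cases c <;>
          simp only [Bool.toNat_true, Bool.toNat_false, Nat.cast_one, Nat.cast_zero] <;> linarith
    · rintro ⟨α, β, γ, -, h⟩ L - x
      simp only [h]
      have s1 : ∀ g : ZMod (L + 1) → ℝ, ∑ i, g (i + 1) = ∑ i, g i :=
        fun g => Equiv.sum_comp (Equiv.addRight (1 : ZMod (L + 1))) g
      have s2 : ∀ g : ZMod (L + 1) → ℝ, ∑ i, g (i + 2) = ∑ i, g i :=
        fun g => Equiv.sum_comp (Equiv.addRight (2 : ZMod (L + 1))) g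
      have a1 := s1 (fun i => ((x i).toNat : ℝ))
      have a2 := s2 (fun i => ((x i).toNat : ℝ))
      have a3 := s1 (fun i => ((x i).toNat : ℝ) * ((x (i + 1)).toNat : ℝ))
      have e : ∀ i : ZMod (L + 1), i + 1 + 1 = i + 2 := fun i => by ring
      simp only [e] at a3
      have v0 : (((0 : Fin 3) : ℕ) : ZMod (L + 1)) = 0 := by simp
      have v1 : (((1 : Fin 3) : ℕ) : ZMod (L + 1)) = 1 := by simp
      have v2 : (((2 : Fin 3) : ℕ) : ZMod (L + 1)) = 2 := by simp
      simp only [v0, v1, v2, add_zero, Finset.sum_add_distrib, ← Finset.mul_sum,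
        Finset.sum_sub_distrib, a1, a2, a3]
      ring
  · rintro α β γ ⟨-, h⟩
    refine ⟨by simp [h], by simp [h], ?_⟩
    simp [h]
    ring
end

section
/- A function f : {0,1}^3 → {0,1} is number-conserving if and only if f is one of the following five functions: f(x_1,x_2,x_3) = x_1 (ECA rule 240); f(x_1,x_2,x_3) = x_1 − x_1 x_2 + x_2 x_3 (ECA rule 184); f(x_1,x_2,x_3) = x_2 (ECA rule 204); f(x_1,x_2,x_3) = x_3 + x_1 x_2 − x_2 x_3 (ECA rule 226); f(x_1,x_2,x_3) = x_3 (ECA rule 170). -/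
open Finset

theorem aux_shift {L : ℕ} (g : ZMod (L + 1) → ℝ) (c : ZMod (L + 1)) :
    ∑ i, g (i + c) = ∑ i, g i :=
  Equiv.sum_comp (Equiv.addRight c) g

theorem aux_fwd (g : Bool → Bool → Bool → Bool)
    (h : ∀ a b c d : Bool, (g a b c).toNat + (g b c d).toNat + (g c d a).toNat + (g d a b).toNat
      = a.toNat + b.toNat + c.toNat + d.toNat) :
    (∀ a b c, g a b c = a) ∨ (∀ a b c, g a b c = bif b then c else a) ∨ (∀ a b c, g a b c = b) ∨
    (∀ a b c, g a b c = bif b then a else c) ∨ (∀ a b c, g a b c = c) := by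
  have h0 := h false false false false
  have h1 := h true false false false
  have h2 := h true true false false
  have h3 := h true false true false
  have h4 := h true true true false
  have h5 := h true true true true
  clear h
  simp only [Bool.forall_bool]
  revert h0 h1 h2 h3 h4 h5
  generalize g false false false = a0
  generalize g false false true = a1
  generalize g false true false = a2
  generalize g false true true = a3
  generalize g true false false = a4
  generalize g true false true = a5
  generalize g true true false = a6
  generalize g true true true = a7
  cases a0 <;> cases a1 <;> cases a2 <;> cases a3 <;> cases a4 <;> cases a5 <;> cases a6 <;>
    cases a7 <;> decide

/-- a deterministic local function `f : {0,1}³ → {0,1}` is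
number-conserving iff it is one of the five elementary CA rules 240, 184, 204,
226, 170, i.e. `f(x₁,x₂,x₃)` equals `x₁`, `x₁ - x₁x₂ + x₂x₃`, `x₂`,
`x₃ + x₁x₂ - x₂x₃`, or `x₃`. -/
theorem statement6 (f : (Fin 3 → Bool) → Bool) :
    NumberConserving (fun v => ((f v).toNat : ℝ)) ↔
      ((∀ x : Fin 3 → Bool, ((f x).toNat : ℝ) = ((x 0).toNat : ℝ)) ∨
       (∀ x : Fin 3 → Bool, ((f x).toNat : ℝ) =
          ((x 0).toNat : ℝ) - ((x 0).toNat : ℝ) * ((x 1).toNat : ℝ) +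
            ((x 1).toNat : ℝ) * ((x 2).toNat : ℝ)) ∨
       (∀ x : Fin 3 → Bool, ((f x).toNat : ℝ) = ((x 1).toNat : ℝ)) ∨
       (∀ x : Fin 3 → Bool, ((f x).toNat : ℝ) =
          ((x 2).toNat : ℝ) + ((x 0).toNat : ℝ) * ((x 1).toNat : ℝ) -
            ((x 1).toNat : ℝ) * ((x 2).toNat : ℝ)) ∨
       (∀ x : Fin 3 → Bool, ((f x).toNat : ℝ) = ((x 2).toNat : ℝ))) := by
  have hv : ∀ v : Fin 3 → Bool, v = ![v 0, v 1, v 2] := by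
    intro v; ext j; fin_cases j <;> rfl
  constructor
  · intro h
    have h4 : ∀ a b c d : Bool, (f ![a, b, c]).toNat + (f ![b, c, d]).toNat + (f ![c, d, a]).toNat
        + (f ![d, a, b]).toNat = a.toNat + b.toNat + c.toNat + d.toNat := by
      intro a b c d
      obtain ⟨x, x0, x1, x2, x3⟩ : ∃ x : ZMod (3 + 1) → Bool,
          x 0 = a ∧ x 1 = b ∧ x 2 = c ∧ x 3 = d :=
        ⟨(![a, b, c, d] : Fin 4 → Bool), rfl, rfl, rfl, rfl⟩
      have h := h 3 (by norm_num) x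
      have e : ∀ F : ZMod (3 + 1) → ℝ, ∑ i, F i = F 0 + F 1 + F 2 + F 3 :=
        fun F => Fin.sum_univ_four (F : Fin 4 → ℝ)
      rw [e, e] at h
      beta_reduce at h
      have c0 : (fun j : Fin 3 => x (0 + ((j : ℕ) : ZMod (3 + 1)))) = ![a, b, c] := by
        subst x0 x1 x2 x3; ext j; fin_cases j <;> rfl
      have c1 : (fun j : Fin 3 => x (1 + ((j : ℕ) : ZMod (3 + 1)))) = ![b, c, d] := by
        subst x0 x1 x2 x3; ext j; fin_cases j <;> rfl
      have c2 : (fun j : Fin 3 => x (2 + ((j : ℕ) : ZMod (3 + 1)))) = ![c, d, a] := by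
        subst x0 x1 x2 x3; ext j; fin_cases j <;> rfl
      have c3 : (fun j : Fin 3 => x (3 + ((j : ℕ) : ZMod (3 + 1)))) = ![d, a, b] := by
        subst x0 x1 x2 x3; ext j; fin_cases j <;> rfl
      rw [c0, c1, c2, c3, x0, x1, x2, x3] at h
      exact_mod_cast h
    have key := aux_fwd (fun a b c => f ![a, b, c]) h4
    rcases key with h | h | h | h | h
    · left; intro x; rw [hv x, h]; rfl
    · right; left; intro x; rw [hv x, h]
      cases x 0 <;> cases x 1 <;> cases x 2 <;> simp
    · right; right; left; intro x; rw [hv x, h]; rfl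
    · right; right; right; left; intro x; rw [hv x, h]
      cases x 0 <;> cases x 1 <;> cases x 2 <;> simp
    · right; right; right; right; intro x; rw [hv x, h]; rfl
  · intro h L _ x
    have s1 := aux_shift (fun i => ((x i).toNat : ℝ)) 1
    have s2 := aux_shift (fun i => ((x i).toNat : ℝ)) 2
    have s3 := aux_shift (fun i => ((x i).toNat : ℝ) * ((x (i + 1)).toNat : ℝ)) 1
    have e : ∀ i : ZMod (L + 1), i + 1 + 1 = i + 2 := by intro i; ring
    simp only [e] at s3
    rcases h with h | h | h | h | h <;>
      simp [h, Finset.sum_add_distrib, Finset.sum_sub_distrib, s1, s2, s3]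
end

section
/- Let ρ ∈ [0,1], let μ be the Bernoulli product measure on {0,1}^ℤ in which each site independently equals 1 with probability ρ, and let F : {0,1}^ℤ → {0,1}^ℤ be elementary CA rule 184, defined by (F x)_i = x_{i−1}(1 − x_i) + x_i x_{i+1}. Then for every integer k ≥ 0, the measure of the cylinder event {x : x_0 = 1 and x_1 = 0} under the pushforward of μ by the k-th iterate F^k equals 1 − ρ − Σ_{i=1}^{k+1} (i/(k+1)) · C(2k+2, k+1−i) · ρ^{k+1−i} (1−ρ)^{k+1+i}, where C(·,·) denotes the binomial coefficient. -/
open Finset MeasureTheory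

namespace R184

def st (b : Bool) : ℤ := if b then -1 else 1

def minL : List Bool → ℤ
  | [] => 0
  | b :: l => min 0 (st b + minL l)

lemma minL_nonpos (l : List Bool) : minL l ≤ 0 := by
  cases l <;> simp [minL]

def E (ρ : ℝ) : ℕ → (List Bool → ℝ) → ℝ
  | 0, φ => φ []
  | N + 1, φ => ρ * E ρ N (fun l => φ (true :: l)) + (1 - ρ) * E ρ N (fun l => φ (false :: l))

lemma E_const (ρ c : ℝ) (N : ℕ) : E ρ N (fun _ => c) = c := by
  induction N with
  | zero => rfl
  | succ n ih => simp only [E, ih]; ring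

lemma E_sub (ρ : ℝ) (N : ℕ) : ∀ (f g : List Bool → ℝ),
    E ρ N (fun l => f l - g l) = E ρ N f - E ρ N g := by
  induction N with
  | zero => intros; rfl
  | succ n ih => intro f g; simp only [E, ih]; ring

lemma E_nonneg (ρ : ℝ) (h0 : 0 ≤ ρ) (h1 : ρ ≤ 1) (N : ℕ) : ∀ (f : List Bool → ℝ)
    (_ : ∀ l, 0 ≤ f l), 0 ≤ E ρ N f := by
  induction N with
  | zero => intro f hf; exact hf _
  | succ n ih =>
    intro f hf
    have := ih (fun l => f (true :: l)) (fun l => hf _)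
    have := ih (fun l => f (false :: l)) (fun l => hf _)
    have : 0 ≤ 1 - ρ := by linarith
    simp only [E]; positivity

open Classical in
noncomputable def ind (P : List Bool → Prop) (l : List Bool) : ℝ := if P l then 1 else 0

lemma ind_pos {P : List Bool → Prop} {l : List Bool} (h : P l) : ind P l = 1 := if_pos h
lemma ind_neg {P : List Bool → Prop} {l : List Bool} (h : ¬ P l) : ind P l = 0 := if_neg h

def Z (h : ℤ) (l : List Bool) : Prop := 0 ≤ h + minL l
def O (l : List Bool) : Prop := minL l % 2 = 1

noncomputable def g (ρ : ℝ) (N : ℕ) (h : ℤ) : ℝ := E ρ N (ind (Z h))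
noncomputable def a (ρ : ℝ) (N : ℕ) : ℝ := E ρ N (ind O)

lemma g_neg (ρ : ℝ) (N : ℕ) (h : ℤ) (hh : h < 0) : g ρ N h = 0 := by
  have : ind (Z h) = fun _ => (0 : ℝ) := by
    funext l
    have := minL_nonpos l
    exact ind_neg (by simp only [Z]; omega)
  rw [g, this, E_const]

lemma g_zero (ρ : ℝ) (h : ℤ) (hh : 0 ≤ h) : g ρ 0 h = 1 := by
  simp [g, E, ind, Z, minL, hh]

lemma g_succ (ρ : ℝ) (N : ℕ) (h : ℤ) (hh : 0 ≤ h) :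
    g ρ (N + 1) h = ρ * g ρ N (h - 1) + (1 - ρ) * g ρ N (h + 1) := by
  have h1 : (fun l => ind (Z h) (true :: l)) = ind (Z (h - 1)) := by
    funext l
    simp only [ind, Z, minL, st]
    congr 1
    simp only [if_true, eq_iff_iff]
    omega
  have h2 : (fun l => ind (Z h) (false :: l)) = ind (Z (h + 1)) := by
    funext l
    simp only [ind, Z, minL, st]
    congr 1
    simp only [eq_iff_iff, Bool.false_eq_true, if_false]
    omega
  simp only [g, E, h1, h2]

lemma a_succ (ρ : ℝ) (N : ℕ) : a ρ (N + 1) = 1 - a ρ N - (1 - ρ) * g ρ N 0 := by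
  have h1 : (fun l => ind O (true :: l)) = fun l => 1 - ind O l := by
    funext l
    have := minL_nonpos l
    by_cases h : O l
    · rw [ind_pos h, ind_neg]
      · norm_num
      · simp only [O, minL, st, if_true] at *; omega
    · rw [ind_neg h, ind_pos]
      · norm_num
      · simp only [O, minL, st, if_true] at *; omega
  have h2 : (fun l => ind O (false :: l)) = fun l => (1 - ind O l) - ind (Z 0) l := by
    funext l
    have := minL_nonpos l
    by_cases h : O l
    · rw [ind_pos h, ind_neg, ind_neg]
      · norm_num
      · simp only [O, Z] at *; omega
      · simp only [O, minL, st, Bool.false_eq_true, if_false] at *; omega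
    · by_cases h' : Z 0 l
      · rw [ind_neg h, ind_pos h', ind_neg]
        · norm_num
        · simp only [O, Z, minL, st, Bool.false_eq_true, if_false] at *; omega
      · rw [ind_neg h, ind_neg h', ind_pos]
        · norm_num
        · simp only [O, Z, minL, st, Bool.false_eq_true, if_false] at *; omega
  simp only [a, g, E, h1, h2, E_sub, E_const]
  ring

lemma g_par (ρ : ℝ) (N : ℕ) : ∀ h : ℤ, (N + h) % 2 = 1 → g ρ (N + 1) h = g ρ N h := by
  induction N with
  | zero =>
    intro h hh
    rcases lt_or_ge h 0 with h0 | h0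
    · rw [g_neg _ _ _ h0, g_neg _ _ _ h0]
    · rw [g_succ _ _ _ h0, g_zero _ _ h0, g_zero _ _ (by push_cast at hh; omega),
        g_zero _ _ (by omega)]
      ring
  | succ n ih =>
    intro h hh
    push_cast at hh
    rcases lt_or_ge h 0 with h0 | h0
    · rw [g_neg _ _ _ h0, g_neg _ _ _ h0]
    · rw [g_succ _ _ _ h0, g_succ _ n _ h0, ih _ (by omega), ih _ (by omega)]

lemma a_even (ρ : ℝ) (k : ℕ) : a ρ (2 * k + 2) = (1 - ρ) * (1 - g ρ (2 * k + 1) 0) := by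
  induction k with
  | zero =>
    have : a ρ 0 = 0 := by simp [a, E, ind, O, minL]
    rw [a_succ, a_succ]
    simp only [mul_zero]
    rw [this, g_zero _ _ le_rfl]; ring
  | succ k ih =>
    have e : 2 * (k + 1) + 2 = (2 * k + 2) + 1 + 1 := by ring
    have e' : 2 * (k + 1) + 1 = (2 * k + 2) + 1 := by ring
    rw [e, e', a_succ, a_succ, ih]
    have := g_par ρ (2 * k + 1) 0 (by push_cast; omega)
    rw [show 2 * k + 2 = 2 * k + 1 + 1 by ring, this]
    ring

noncomputable def u (ρ : ℝ) (m i : ℕ) : ℝ := g ρ (2 * m) (2 * i + 1)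

lemma u_zero (ρ : ℝ) (i : ℕ) : u ρ 0 i = 1 := g_zero _ _ (by positivity)

lemma u_succ_zero (ρ : ℝ) (m : ℕ) : u ρ (m + 1) 0 =
    2 * ρ * (1 - ρ) * u ρ m 0 + (1 - ρ) ^ 2 * u ρ m 1 := by
  simp only [u]
  rw [show 2 * (m + 1) = 2 * m + 1 + 1 by ring, g_succ _ _ _ (by simp), g_succ _ _ _ (by simp),
    g_succ _ _ _ (by simp), g_neg _ _ _ (by simp)]
  norm_num
  ring

lemma u_succ_succ (ρ : ℝ) (m i : ℕ) : u ρ (m + 1) (i + 1) = ρ ^ 2 * u ρ m i +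
    2 * ρ * (1 - ρ) * u ρ m (i + 1) + (1 - ρ) ^ 2 * u ρ m (i + 2) := by
  simp only [u]
  rw [show 2 * (m + 1) = 2 * m + 1 + 1 by ring, g_succ _ _ _ (by positivity),
    g_succ _ _ _ (by push_cast; omega), g_succ _ _ _ (by push_cast; omega)]
  push_cast
  rw [show (2 * ((i : ℤ) + 1) + 1 - 1 - 1) = 2 * i + 1 by ring,
    show (2 * ((i : ℤ) + 1) + 1 - 1 + 1) = 2 * (i + 1) + 1 by ring,
    show (2 * ((i : ℤ) + 1) + 1 + 1 - 1) = 2 * (i + 1) + 1 by ring,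
    show (2 * ((i : ℤ) + 1) + 1 + 1 + 1) = 2 * (i + 2) + 1 by ring]
  ring

def T (N : ℕ) : ℕ → ℝ
  | 0 => 1
  | j + 1 => (N.choose (j + 1) : ℝ) - N.choose j

lemma T_succ (N j : ℕ) : T (N + 1) (j + 1) = T N j + T N (j + 1) := by
  cases j with
  | zero => simp [T]
  | succ j => simp only [T, Nat.choose_succ_succ]; push_cast; ring

lemma T_two (N j : ℕ) : T (N + 1 + 1) (j + 1 + 1) = T N j + 2 * T N (j + 1) + T N (j + 1 + 1) := by
  rw [T_succ, T_succ, T_succ]; ring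

lemma T_mid (m : ℕ) : T (2 * m + 1) (m + 1) = 0 := by
  simp only [T]
  rw [Nat.choose_symm_half]; ring

lemma T_formula (N j : ℕ) : (N + 1 : ℝ) * T N j = (N + 1 - 2 * j) * (N + 1).choose j := by
  cases j with
  | zero => simp [T]
  | succ j =>
    simp only [T]
    have h1 : ((N + 1 : ℕ) : ℝ) * (N.choose j) = (N + 1).choose (j + 1) * ((j + 1 : ℕ) : ℝ) := by
      exact_mod_cast Nat.add_one_mul_choose_eq N j
    have h2 : ((N + 1).choose (j + 1) : ℝ) = N.choose j + N.choose (j + 1) := by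
      exact_mod_cast Nat.choose_succ_succ N j
    push_cast at *
    have h3 : (N.choose (j + 1) : ℝ) = (N + 1).choose (j + 1) - N.choose j := by linarith
    rw [h3]
    linear_combination -2 * h1

noncomputable def D (ρ : ℝ) (m i : ℕ) : ℝ :=
  if i ≤ m then T (2 * m + 1) (m - i) * ρ ^ (m - i) * (1 - ρ) ^ (m + i) else 0

lemma D_big (ρ : ℝ) (m i : ℕ) (h : m < i) : D ρ m i = 0 := by simp [D, h]

lemma D_zero (ρ : ℝ) (m : ℕ) : D ρ (m + 1) 0 =
    2 * ρ * (1 - ρ) * D ρ m 0 + ρ ^ 2 * D ρ m 1 := by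
  cases m with
  | zero => simp [D, T]; norm_num
  | succ m =>
    simp only [D, Nat.zero_le, if_true, Nat.sub_zero, add_zero, Nat.le_add_left,
      Nat.add_sub_cancel]
    rw [show 2 * (m + 1 + 1) + 1 = 2 * (m + 1) + 1 + 1 + 1 by ring, T_two, T_mid]
    ring

lemma D_succ (ρ : ℝ) (m i : ℕ) : D ρ (m + 1) (i + 1) = (1 - ρ) ^ 2 * D ρ m i +
    2 * ρ * (1 - ρ) * D ρ m (i + 1) + ρ ^ 2 * D ρ m (i + 2) := by
  rcases lt_or_ge m i with h | h
  · rw [D_big _ _ _ (by omega), D_big _ _ _ (by omega), D_big _ _ _ (by omega),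
      D_big _ _ _ (by omega)]; ring
  obtain ⟨j, rfl⟩ := Nat.exists_eq_add_of_le h
  rcases j with _ | _ | j
  · rw [add_zero, D_big ρ i (i + 1) (by omega), D_big ρ i (i + 2) (by omega)]
    simp only [D, le_refl, if_true, Nat.sub_self, T]; ring
  · rw [D_big _ _ (i + 2) (by omega)]
    simp only [D]
    rw [if_pos (by omega), if_pos (by omega), if_pos (by omega),
      show i + (0 + 1) + 1 - (i + 1) = 0 + 1 by omega, show i + (0 + 1) - i = 0 + 1 by omega,
      show i + (0 + 1) - (i + 1) = 0 by omega,
      show 2 * (i + (0 + 1) + 1) + 1 = 2 * (i + (0 + 1)) + 1 + 1 + 1 by ring, T_succ, T_succ]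
    simp only [T]
    ring
  · simp only [D]
    rw [if_pos (by omega), if_pos (by omega), if_pos (by omega), if_pos (by omega),
      show i + (j + 1 + 1) + 1 - (i + 1) = j + 1 + 1 by omega,
      show i + (j + 1 + 1) - i = j + 1 + 1 by omega,
      show i + (j + 1 + 1) - (i + 1) = j + 1 by omega,
      show i + (j + 1 + 1) - (i + 2) = j by omega,
      show 2 * (i + (j + 1 + 1) + 1) + 1 = 2 * (i + (j + 1 + 1)) + 1 + 1 + 1 by ring, T_two]
    ring

lemma dual (ρ : ℝ) (m : ℕ) : ∀ r, u ρ (m + r) 0 = ∑ i ∈ range (m + 1), D ρ m i * u ρ r i := by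
  induction m with
  | zero => intro r; simp [D, T]
  | succ m ih =>
    intro r
    rw [show m + 1 + r = m + (r + 1) by ring, ih, sum_range_succ', u_succ_zero]
    simp only [u_succ_succ]
    rw [sum_range_succ' _ (m + 1), D_zero]
    simp only [D_succ]
    have e1 : ∑ i ∈ range (m + 1), D ρ m (i + 1) * u ρ r (i + 1)
        = ∑ i ∈ range m, D ρ m (i + 1) * u ρ r (i + 1) := by
      rw [sum_range_succ, D_big ρ m (m + 1) (by omega)]; ring
    have e2 : ∑ i ∈ range (m + 1), D ρ m i * u ρ r (i + 1)
        = ∑ i ∈ range m, D ρ m (i + 1) * u ρ r (i + 2) + D ρ m 0 * u ρ r 1 := by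
      rw [sum_range_succ']
    have e3 : ∑ i ∈ range m, D ρ m (i + 1) * u ρ r i
        = ∑ i ∈ range (m + 1), D ρ m (i + 2) * u ρ r (i + 1) + D ρ m 1 * u ρ r 0 := by
      rw [← sum_range_succ' (fun i => D ρ m (i + 1) * u ρ r i), sum_range_succ, sum_range_succ,
        D_big ρ m (m + 1) (by omega), D_big ρ m (m + 1 + 1) (by omega)]
      ring
    have l1 : ∑ i ∈ range m, D ρ m (i + 1) * (ρ ^ 2 * u ρ r i +
        2 * ρ * (1 - ρ) * u ρ r (i + 1) + (1 - ρ) ^ 2 * u ρ r (i + 2)) =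
        ρ ^ 2 * ∑ i ∈ range m, D ρ m (i + 1) * u ρ r i
        + 2 * ρ * (1 - ρ) * ∑ i ∈ range m, D ρ m (i + 1) * u ρ r (i + 1)
        + (1 - ρ) ^ 2 * ∑ i ∈ range m, D ρ m (i + 1) * u ρ r (i + 2) := by
      simp only [mul_sum, ← sum_add_distrib]
      exact sum_congr rfl fun _ _ => by ring
    have l2 : ∑ i ∈ range (m + 1), ((1 - ρ) ^ 2 * D ρ m i +
        2 * ρ * (1 - ρ) * D ρ m (i + 1) + ρ ^ 2 * D ρ m (i + 2)) * u ρ r (i + 1) =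
        (1 - ρ) ^ 2 * ∑ i ∈ range (m + 1), D ρ m i * u ρ r (i + 1)
        + 2 * ρ * (1 - ρ) * ∑ i ∈ range (m + 1), D ρ m (i + 1) * u ρ r (i + 1)
        + ρ ^ 2 * ∑ i ∈ range (m + 1), D ρ m (i + 2) * u ρ r (i + 1) := by
      simp only [mul_sum, ← sum_add_distrib]
      exact sum_congr rfl fun _ _ => by ring
    rw [l1, l2, e1, e2, e3]
    ring

lemma a_final (ρ : ℝ) (k : ℕ) : a ρ (2 * k + 2) = 1 - ρ -
          ∑ i ∈ Finset.Icc 1 (k + 1),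
            ((i : ℝ) / ((k : ℝ) + 1)) * ((2 * k + 2).choose (k + 1 - i) : ℝ) *
              ρ ^ (k + 1 - i) * (1 - ρ) ^ (k + 1 + i) := by
  have h1 : g ρ (2 * k + 1) 0 = (1 - ρ) * u ρ k 0 := by
    rw [g_succ _ _ _ le_rfl, g_neg _ _ _ (by norm_num), u]; norm_num
  have h2 := dual ρ k 0
  simp only [u_zero, add_zero, mul_one] at h2
  rw [a_even, h1, h2]
  have h3 : ∑ i ∈ Finset.Icc 1 (k + 1),
            ((i : ℝ) / ((k : ℝ) + 1)) * ((2 * k + 2).choose (k + 1 - i) : ℝ) *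
              ρ ^ (k + 1 - i) * (1 - ρ) ^ (k + 1 + i)
      = (1 - ρ) ^ 2 * ∑ i ∈ range (k + 1), D ρ k i := by
    rw [← Finset.Ico_add_one_right_eq_Icc, Finset.sum_Ico_eq_sum_range, mul_sum]
    refine sum_congr (by simp) fun i hi => ?_
    have hi' : i ≤ k := by simp at hi; omega
    have hT := T_formula (2 * k + 1) (k - i)
    rw [D, if_pos hi', show k + 1 - (1 + i) = k - i by omega]
    have hk : (k : ℝ) + 1 ≠ 0 := by positivity
    have hT' : T (2 * k + 1) (k - i) = ((1 + i : ℕ) : ℝ) / (k + 1) * ((2 * k + 2).choose (k - i)) := by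
      rw [Nat.cast_sub hi'] at hT
      push_cast at hT ⊢
      field_simp
      linear_combination hT / 2
    rw [hT']
    ring
  rw [h3]; ring

/-! deterministic part -/

def Comp (h : ℤ → ℤ) (x : ℤ → Bool) : Prop := ∀ j, h j = h (j - 1) + st (x j)

lemma exists_height (x : ℤ → Bool) : ∃ h, Comp h x := by
  refine ⟨fun j => match j with
    | Int.ofNat n => ∑ i ∈ range n, st (x ((i : ℤ) + 1))
    | Int.negSucc n => - ∑ i ∈ range (n + 1), st (x (-(i : ℤ))), ?_⟩
  intro j
  rcases j with n | n
  · rcases n with _ | n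
    · have : (Int.ofNat 0 - 1) = Int.negSucc 0 := rfl
      rw [this]; simp
    · have : (Int.ofNat (n + 1) - 1) = Int.ofNat n := by simp
      rw [this]; simp [sum_range_succ]
  · have : (Int.negSucc n - 1) = Int.negSucc (n + 1) := rfl
    rw [this]
    simp only
    rw [sum_range_succ _ (n + 1)]
    have : (Int.negSucc n) = -((n + 1 : ℕ) : ℤ) := rfl
    rw [this]; ring

def m (h : ℤ → ℤ) : ℕ → ℤ → ℤ
  | 0 => h
  | k + 1 => fun j => min (m h k (j - 1)) (m h k (j + 1))

lemma F_val (F : (ℤ → Bool) → (ℤ → Bool))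
    (hF : ∀ (x : ℤ → Bool) (i : ℤ),
      ((F x i).toNat : ℝ) =
        ((x (i - 1)).toNat : ℝ) * (1 - ((x i).toNat : ℝ)) +
          ((x i).toNat : ℝ) * ((x (i + 1)).toNat : ℝ)) (x : ℤ → Bool) (i : ℤ) :
    F x i = if x i then x (i + 1) else x (i - 1) := by
  have := hF x i
  revert this
  generalize F x i = c
  cases c <;> cases x i <;> cases x (i - 1) <;> cases x (i + 1) <;> simp

lemma comp_step (F : (ℤ → Bool) → (ℤ → Bool))
    (hF : ∀ x i, F x i = if x i then x (i + 1) else x (i - 1)) (h : ℤ → ℤ) (x : ℤ → Bool)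
    (hc : Comp h x) : Comp (fun j => min (h (j - 1)) (h (j + 1))) (F x) := by
  intro j
  have h1 := hc j
  have h2 := hc (j + 1)
  have h3 := hc (j - 1)
  simp only [sub_add_cancel, add_sub_cancel_right] at *
  rw [hF]
  revert h1 h2 h3
  cases x j <;> cases x (j - 1) <;> cases x (j + 1) <;> simp [st] <;> omega

lemma comp_iter (F : (ℤ → Bool) → (ℤ → Bool))
    (hF : ∀ x i, F x i = if x i then x (i + 1) else x (i - 1)) (h : ℤ → ℤ) (x : ℤ → Bool)
    (hc : Comp h x) (k : ℕ) : Comp (m h k) (F^[k] x) := by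
  induction k with
  | zero => exact hc
  | succ k ih => rw [Function.iterate_succ_apply']; exact comp_step F hF _ _ ih

lemma le_m (h : ℤ → ℤ) (z : ℤ) (k : ℕ) : ∀ j : ℤ,
    z ≤ m h k j ↔ ∀ i : ℕ, i ≤ k → z ≤ h (j - k + 2 * i) := by
  induction k with
  | zero => intro j; simp [m]
  | succ k ih =>
    intro j
    simp only [m, le_min_iff, ih]
    constructor
    · rintro ⟨h1, h2⟩ i hi
      rcases Nat.lt_or_ge i (k + 1) with h' | h'
      · have := h1 i (by omega)
        convert this using 2
        push_cast; ring
      · have := h2 k le_rfl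
        have e : i = k + 1 := by omega
        subst e
        convert this using 2
        push_cast; ring
    · intro H
      constructor
      · intro i hi
        have := H i (by omega)
        convert this using 2
        push_cast; ring
      · intro i hi
        have := H (i + 1) (by omega)
        convert this using 2
        push_cast; ring

def win (x : ℤ → Bool) : ℕ → ℤ → List Bool
  | 0, _ => []
  | N + 1, b => x b :: win x N (b + 1)

lemma le_win (h : ℤ → ℤ) (x : ℤ → Bool) (hc : Comp h x) (z : ℤ) (N : ℕ) : ∀ b : ℤ,
    z ≤ h b + minL (win x N (b + 1)) ↔ ∀ n : ℕ, n ≤ N → z ≤ h (b + n) := by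
  induction N with
  | zero => intro b; simp [minL, win]
  | succ N ih =>
    intro b
    have hb := hc (b + 1)
    simp only [add_sub_cancel_right] at hb
    simp only [minL, win]
    have : z ≤ h b + min 0 (st (x (b + 1)) + minL (win x N (b + 1 + 1))) ↔
      z ≤ h b ∧ z ≤ h (b + 1) + minL (win x N (b + 1 + 1)) := by omega
    rw [this, ih]
    constructor
    · rintro ⟨h1, h2⟩ n hn
      rcases n with _ | n
      · simpa using h1
      · have := h2 n (by omega)
        convert this using 2
        push_cast; ring
    · intro H
      refine ⟨by simpa using H 0 (by omega), fun n hn => ?_⟩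
      have := H (n + 1) (by omega)
      convert this using 2
      push_cast; ring

lemma win_eq (h : ℤ → ℤ) (x : ℤ → Bool) (hc : Comp h x) (k : ℕ) :
    h (-(k + 1)) + minL (win x (2 * k + 2) (-k)) = min (m h k 0) (m h (k + 1) 0) := by
  refine eq_of_forall_le_iff fun z => ?_
  have := le_win h x hc z (2 * k + 2) (-(k + 1))
  rw [show (-((k : ℤ) + 1) + 1) = -k by ring] at this
  rw [this, le_min_iff, le_m, le_m]
  constructor
  · intro H
    constructor
    · intro i hi
      have := H (2 * i + 1) (by omega)
      convert this using 2
      push_cast; ring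
    · intro i hi
      have := H (2 * i) (by omega)
      convert this using 2
      push_cast; ring
  · rintro ⟨h1, h2⟩ n hn
    obtain ⟨i, hi | hi⟩ := Nat.even_or_odd' n
    · have := h2 i (by omega)
      rw [hi]
      convert this using 2
      push_cast; ring
    · have := h1 i (by omega)
      rw [hi]
      convert this using 2
      push_cast; ring

lemma st_cases (b : Bool) : (b = true ∧ st b = -1) ∨ (b = false ∧ st b = 1) := by
  cases b <;> simp [st]

lemma par_h (h : ℤ → ℤ) (x : ℤ → Bool) (hc : Comp h x) (n : ℕ) :
    (h (-(n : ℤ)) + n) % 2 = h 0 % 2 := by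
  induction n with
  | zero => simp
  | succ n ih =>
    have := hc (-(n : ℤ))
    rw [show -(n : ℤ) - 1 = -((n + 1 : ℕ) : ℤ) by push_cast; ring] at this
    rcases st_cases (x (-(n : ℤ))) with h' | h' <;> push_cast at * <;> omega

lemma par_h' (h : ℤ → ℤ) (x : ℤ → Bool) (hc : Comp h x) (j : ℤ) :
    (h j - h (j - 1)) % 2 = 1 := by
  have := hc j
  rcases st_cases (x j) with h' | h' <;> omega

lemma par_m (h : ℤ → ℤ) (x : ℤ → Bool) (hc : Comp h x) (k : ℕ) : ∀ j,
    (m h k j + k) % 2 = h j % 2 := by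
  induction k with
  | zero => intro j; simp [m]
  | succ k ih =>
    intro j
    have h1 := ih (j - 1)
    have h2 := ih (j + 1)
    have h3 := par_h' h x hc j
    have h4 := par_h' h x hc (j + 1)
    simp only [add_sub_cancel_right] at h4
    simp only [m]
    push_cast
    omega

lemma event_iff (F : (ℤ → Bool) → (ℤ → Bool))
    (hF : ∀ x i, F x i = if x i then x (i + 1) else x (i - 1)) (x : ℤ → Bool) (k : ℕ) :
    (F^[k] x 0 = true ∧ F^[k] x 1 = false) ↔ O (win x (2 * k + 2) (-k)) := by
  obtain ⟨h, hc⟩ := exists_height x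
  have hk := comp_iter F hF h x hc k
  have h0 := hk 0
  have h1 := hk 1
  have hw := win_eq h x hc k
  have p1 := par_m h x hc k 0
  have p2 := par_m h x hc (k + 1) 0
  have p3 := par_h h x hc (k + 1)
  have hm : m h (k + 1) 0 = min (m h k (-1)) (m h k 1) := by simp [m]
  simp only [O]
  rw [show (0 : ℤ) - 1 = -1 by norm_num] at h0
  rw [show (1 : ℤ) - 1 = 0 by norm_num] at h1
  push_cast at *
  rcases st_cases (F^[k] x 0) with ⟨q, q'⟩ | ⟨q, q'⟩ <;>
  rcases st_cases (F^[k] x 1) with ⟨r, r'⟩ | ⟨r, r'⟩ <;>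
  simp only [q, r, true_and, and_true, and_false, false_and, Bool.false_eq_true,
    Bool.true_eq_false, false_iff, true_iff] <;> omega

lemma ind_E (ρ : ℝ) (hρ : ρ ∈ Set.Icc (0 : ℝ) 1)
    (μ : Measure (ℤ → Bool)) [IsProbabilityMeasure μ]
    (hμ : ∀ (s : Finset ℤ) (u : ℤ → Bool),
      μ {x | ∀ i ∈ s, x i = u i} =
        ∏ i ∈ s, ENNReal.ofReal (if u i then ρ else 1 - ρ)) (N : ℕ) :
    ∀ (P : List Bool → Prop) (b : ℤ) (s : Finset ℤ) (_ : ∀ i ∈ s, i < b) (u : ℤ → Bool),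
      μ {x | (∀ i ∈ s, x i = u i) ∧ P (win x N b)} =
        (∏ i ∈ s, ENNReal.ofReal (if u i then ρ else 1 - ρ)) * ENNReal.ofReal (E ρ N (ind P)) := by
  induction N with
  | zero =>
    intro P b s hs u
    by_cases h : P []
    · simp [win, h, E, ind, hμ]
    · simp [win, h, E, ind]
  | succ N ih =>
    intro P b s hs u
    have hbs : b ∉ s := fun h => lt_irrefl _ (hs b h)
    have key : ∀ c : Bool, μ {x | x b = c ∧ (∀ i ∈ s, x i = u i) ∧ P (win x (N + 1) b)} =
        ENNReal.ofReal (if c then ρ else 1 - ρ) *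
        (∏ i ∈ s, ENNReal.ofReal (if u i then ρ else 1 - ρ)) *
          ENNReal.ofReal (E ρ N (ind (fun l => P (c :: l)))) := by
      intro c
      have := ih (fun l => P (c :: l)) (b + 1) (insert b s) (by
        intro i hi
        rcases Finset.mem_insert.1 hi with rfl | hi
        · omega
        · have := hs i hi; omega) (Function.update u b c)
      rw [Finset.prod_insert hbs] at this
      simp only [Function.update_self] at this
      rw [Finset.prod_congr rfl (g := fun i => ENNReal.ofReal (if u i then ρ else 1 - ρ))] at this
      · rw [← this]
        congr 1
        ext x
        simp only [Set.mem_setOf_eq, Finset.forall_mem_insert, Function.update_self, win, and_assoc]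
        have e : (∀ i ∈ s, x i = Function.update u b c i) ↔ (∀ i ∈ s, x i = u i) := by
          refine forall₂_congr fun i hi => ?_
          rw [Function.update_of_ne (ne_of_mem_of_not_mem hi hbs)]
        rw [e]
        constructor
        · rintro ⟨h1, h2, h3⟩; rw [h1] at h3; exact ⟨h1, h2, h3⟩
        · rintro ⟨h1, h2, h3⟩; rw [← h1] at h3; exact ⟨h1, h2, h3⟩
      · intro i hi
        rw [Function.update_of_ne (ne_of_mem_of_not_mem hi hbs)]
    have hmeas : MeasurableSet {x : ℤ → Bool | x b = true} :=
      measurableSet_eq_fun (measurable_pi_apply b) measurable_const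
    rw [← measure_inter_add_diff _ hmeas]
    have e1 : {x : ℤ → Bool | (∀ i ∈ s, x i = u i) ∧ P (win x (N + 1) b)} ∩ {x | x b = true} =
        {x | x b = true ∧ (∀ i ∈ s, x i = u i) ∧ P (win x (N + 1) b)} := by
      ext x; simp only [Set.mem_inter_iff, Set.mem_setOf_eq]; tauto
    have e2 : {x : ℤ → Bool | (∀ i ∈ s, x i = u i) ∧ P (win x (N + 1) b)} \ {x | x b = true} =
        {x | x b = false ∧ (∀ i ∈ s, x i = u i) ∧ P (win x (N + 1) b)} := by
      ext x; simp only [Set.mem_diff, Set.mem_setOf_eq, Bool.not_eq_true]; tauto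
    rw [e1, e2, key, key]
    have n1 := E_nonneg ρ hρ.1 hρ.2 N (ind (fun l => P (true :: l)))
      (fun l => by unfold ind; split_ifs <;> norm_num)
    have n2 := E_nonneg ρ hρ.1 hρ.2 N (ind (fun l => P (false :: l)))
      (fun l => by unfold ind; split_ifs <;> norm_num)
    have q0 : 0 ≤ 1 - ρ := by linarith [hρ.2]
    have hE : E ρ (N + 1) (ind P) = ρ * E ρ N (ind (fun l => P (true :: l))) +
      (1 - ρ) * E ρ N (ind (fun l => P (false :: l))) := rfl
    rw [hE, ENNReal.ofReal_add (mul_nonneg hρ.1 n1) (mul_nonneg q0 n2),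
      ENNReal.ofReal_mul hρ.1, ENNReal.ofReal_mul q0]
    simp only [if_true, Bool.false_eq_true, if_false]
    ring

end R184

/-- let `ρ ∈ [0,1]`, let `μ` be the Bernoulli product measure on
`{0,1}^ℤ` (each site independently `1` with probability `ρ`, characterized by its
values on cylinder events), and let `F` be elementary CA rule 184, i.e.
`(F x)ᵢ = x_{i-1}(1 - xᵢ) + xᵢ x_{i+1}`.  Then for every `k ≥ 0`, the pushforward
of `μ` by `F^[k]` gives the cylinder event `{x : x₀ = 1, x₁ = 0}` measure
`1 - ρ - ∑_{i=1}^{k+1} (i/(k+1)) C(2k+2, k+1-i) ρ^{k+1-i} (1-ρ)^{k+1+i}`. -/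
theorem statement10 (ρ : ℝ) (hρ : ρ ∈ Set.Icc (0 : ℝ) 1)
    (μ : Measure (ℤ → Bool)) [IsProbabilityMeasure μ]
    (hμ : ∀ (s : Finset ℤ) (u : ℤ → Bool),
      μ {x | ∀ i ∈ s, x i = u i} =
        ∏ i ∈ s, ENNReal.ofReal (if u i then ρ else 1 - ρ))
    (F : (ℤ → Bool) → (ℤ → Bool))
    (hF : ∀ (x : ℤ → Bool) (i : ℤ),
      ((F x i).toNat : ℝ) =
        ((x (i - 1)).toNat : ℝ) * (1 - ((x i).toNat : ℝ)) +
          ((x i).toNat : ℝ) * ((x (i + 1)).toNat : ℝ)) :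
    ∀ k : ℕ,
      Measure.map (F^[k]) μ {x : ℤ → Bool | x 0 = true ∧ x 1 = false} =
        ENNReal.ofReal (1 - ρ -
          ∑ i ∈ Finset.Icc 1 (k + 1),
            ((i : ℝ) / ((k : ℝ) + 1)) * ((2 * k + 2).choose (k + 1 - i) : ℝ) *
              ρ ^ (k + 1 - i) * (1 - ρ) ^ (k + 1 + i)) := by
  intro k
  have hF' := R184.F_val F hF
  have hm : Measurable F := by
    refine measurable_pi_iff.2 fun i => ?_
    have : (fun x => F x i) = (fun q : Bool × Bool × Bool => if q.1 then q.2.1 else q.2.2) ∘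
        (fun x : ℤ → Bool => (x i, x (i + 1), x (i - 1))) := by
      funext x; simp [hF']
    rw [this]
    exact (measurable_of_finite _).comp (by fun_prop)
  have hS : MeasurableSet {x : ℤ → Bool | x 0 = true ∧ x 1 = false} :=
    (measurableSet_eq_fun (measurable_pi_apply 0) measurable_const).inter
      (measurableSet_eq_fun (measurable_pi_apply 1) measurable_const)
  rw [Measure.map_apply (hm.iterate k) hS, ← R184.a_final]
  have := R184.ind_E ρ hρ μ hμ (2 * k + 2) R184.O (-k) ∅ (by simp) (fun _ => true)
  simp only [Finset.prod_empty, one_mul] at this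
  rw [R184.a, ← this]
  congr 1
  ext x
  simp only [Set.mem_preimage, Set.mem_setOf_eq]
  rw [R184.event_iff F hF' x k]
  simp
end

section
/- For every ρ ∈ [0,1], the sequence j(k,ρ) = 1 − ρ − Σ_{i=1}^{k+1} (i/(k+1)) · C(2k+2, k+1−i) · ρ^{k+1−i} (1−ρ)^{k+1+i} converges as k → ∞, and lim_{k→∞} j(k,ρ) = 1/2 − |ρ − 1/2| (equivalently, min(ρ, 1−ρ)). -/
open Finset Filter

/-- for every `ρ ∈ [0,1]`, the sequence
`j(k,ρ) = 1 - ρ - ∑_{i=1}^{k+1} (i/(k+1)) C(2k+2, k+1-i) ρ^{k+1-i} (1-ρ)^{k+1+i}`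
converges as `k → ∞` to `1/2 - |ρ - 1/2|` (that is, to `min(ρ, 1-ρ)`). -/
theorem statement11 (ρ : ℝ) (hρ : ρ ∈ Set.Icc (0 : ℝ) 1) :
    Tendsto
      (fun k : ℕ => 1 - ρ -
        ∑ i ∈ Finset.Icc 1 (k + 1),
          ((i : ℝ) / ((k : ℝ) + 1)) * ((2 * k + 2).choose (k + 1 - i) : ℝ) *
            ρ ^ (k + 1 - i) * (1 - ρ) ^ (k + 1 + i))
      atTop (nhds (1 / 2 - |ρ - 1 / 2|)) := by
  have hlim : (1 / 2 - |ρ - 1 / 2| : ℝ) = 1 - ρ - max 0 (1 - 2 * ρ) := by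
    rcases le_total ρ (1 / 2) with h | h
    · rw [abs_of_nonpos (by linarith), max_eq_right (by linarith)]; ring
    · rw [abs_of_nonneg (by linarith), max_eq_left (by linarith)]; ring
  rw [hlim]
  refine Tendsto.sub tendsto_const_nhds ?_
  let f : C(unitInterval, ℝ) := ⟨fun x => max 0 (1 - 2 * (x : ℝ)), by fun_prop⟩
  let x : unitInterval := ⟨ρ, hρ⟩
  have h1 : Tendsto (fun n : ℕ => bernsteinApproximation n f x) atTop (nhds (f x)) :=
    ((continuous_eval_const x).tendsto f).comp (bernsteinApproximation_uniform f)
  have h2 : Tendsto (fun k : ℕ => 2 * k + 2) atTop atTop :=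
    tendsto_atTop_mono (fun k => by simp only [id]; omega) tendsto_id
  have h3 := h1.comp h2
  refine h3.congr ?_
  intro k
  simp only [Function.comp, bernsteinApproximation.apply, bernstein_apply, bernstein.z, f, x,
    ContinuousMap.coe_mk, smul_eq_mul]
  rw [Fin.sum_univ_eq_sum_range (fun j : ℕ => (((2 * k + 2).choose j : ℝ) * ρ ^ j *
    (1 - ρ) ^ (2 * k + 2 - j)) * max 0 (1 - 2 * ((j : ℝ) / ((2 * k + 2 : ℕ) : ℝ)))) (2 * k + 2 + 1)]
  have hk : (0 : ℝ) < (k : ℝ) + 1 := by positivity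
  rw [← Finset.sum_subset (s₁ := Finset.range (k + 1))]
  · symm
    refine Finset.sum_bij' (fun i _ => k + 1 - i) (fun j _ => k + 1 - j) ?_ ?_ ?_ ?_ ?_
    · intro i hi; simp only [Finset.mem_Icc, Finset.mem_range] at *; omega
    · intro i hi; simp only [Finset.mem_Icc, Finset.mem_range] at *; omega
    · intro i hi; simp only [Finset.mem_Icc] at *; omega
    · intro i hi; simp only [Finset.mem_range] at *; omega
    · intro i hi
      rw [Finset.mem_Icc] at hi
      have e : 2 * k + 2 - (k + 1 - i) = k + 1 + i := by omega
      have e2 : (1 - 2 * (((k + 1 - i : ℕ) : ℝ) / ((2 * k + 2 : ℕ) : ℝ))) = (i : ℝ) / (k + 1) := by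
        rw [Nat.cast_sub hi.2]
        push_cast
        field_simp
        ring
      rw [e, e2, max_eq_right (by positivity)]
      ring
  · intro j hj; simp only [Finset.mem_range] at *; omega
  · intro j _ hj
    rw [Finset.mem_range, not_lt] at hj
    have hj' : (k : ℝ) + 1 ≤ j := by exact_mod_cast hj
    rw [max_eq_left, mul_zero]
    push_cast
    have : 1 ≤ 2 * ((j : ℝ) / (2 * k + 2)) := by
      rw [← mul_div_assoc, le_div_iff₀ (by positivity)]
      linarith
    linarith
end
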